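/- Let K ≥ 2 be an integer and let Q(K) be the set of positive integers q such that p^(v_p(q)) ≤ K for every prime p. Let q ∈ Q(K) be such that 3 divides q and 2 does not divide q. Then there exists an integer n ≥ 3 such that for every r ∈ Q(K): r divides n−2 if and only if r = 1; r divides n−1 if and only if r divides 4; r divides n if and only if r divides q; if 5 divides q then (r divides n+1 if and only if r divides 2) and if 5 does not divide q then (r divides n+1 if and only if r divides 10); and r divides n+2 if and only if r = 1. -/

import Mathlib

/-- `QSet K` is the set of positive integers `q` such that `p ^ (v_p q) ≤ K`
for every prime `p`. -/
def QSet (K : ℕ) : Set ℕ :=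
  {q | 0 < q ∧ ∀ p : ℕ, Nat.Prime p → p ^ (Nat.factorization q p) ≤ K}

theorem QSet.le_of_prime_dvd {K r p : ℕ} (hr : r ∈ QSet K) (hp : p.Prime) (hpr : p ∣ r) :
    p ≤ K :=
  (Nat.le_self_pow (hp.factorization_pos_of_dvd hr.1.ne' hpr).ne' p).trans (hr.2 p hp)

theorem QSet.coprime_of_forall_prime {K r m : ℕ} (hr : r ∈ QSet K)
    (h : ∀ p : ℕ, p.Prime → p ≤ K → ¬ p ∣ m) : r.Coprime m :=
  Nat.Coprime.symm <| Nat.coprime_of_dvd fun p hp hpm hpr =>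
    h p hp (QSet.le_of_prime_dvd hr hp hpr) hpm

theorem QSet.dvd_mul_iff {K r d m : ℕ} (hr : r ∈ QSet K)
    (h : ∀ p : ℕ, p.Prime → p ≤ K → ¬ p ∣ m) : r ∣ d * m ↔ r ∣ d :=
  (QSet.coprime_of_forall_prime hr h).dvd_mul_right

theorem Nat.exists_modEq_three {a b c : ℕ} (ha : 0 < a) (hb : 0 < b) (hc : 0 < c)
    (hab : a.Coprime b) (hac : a.Coprime c) (hbc : b.Coprime c) (x y z N : ℕ) :
    ∃ n : ℕ, N ≤ n ∧ n ≡ x [MOD a] ∧ n ≡ y [MOD b] ∧ n ≡ z [MOD c] := by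
  obtain ⟨u, hux, huy⟩ := Nat.chineseRemainder hab x y
  obtain ⟨v, hvu, hvz⟩ := Nat.chineseRemainder (Nat.Coprime.mul_left hac hbc) u z
  have hv : v + a * b * c * N ≡ v [MOD a * b * c] := by
    exact Nat.add_mul_mod_self_left v (a * b * c) N
  refine ⟨v + a * b * c * N, ?_, ?_, ?_, ?_⟩
  · have : 0 < a * b * c := by positivity
    nlinarith
  · exact ((hv.of_mul_right c).trans hvu).of_mul_right b |>.trans hux
  · exact ((hv.of_mul_right c).trans hvu).of_mul_left a |>.trans huy
  · exact (hv.of_mul_left (a * b)).trans hvz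

/-- The product of the primes up to `K` that do not divide `m`. -/
def primesProdNotDvd (K m : ℕ) : ℕ :=
  ∏ p ∈ (Finset.range (K + 1)).filter (fun p => p.Prime ∧ ¬ p ∣ m), p

theorem primesProdNotDvd_pos (K m : ℕ) : 0 < primesProdNotDvd K m :=
  Finset.prod_pos fun _ hp => (Finset.mem_filter.1 hp).2.1.pos

theorem coprime_primesProdNotDvd (K m : ℕ) : m.Coprime (primesProdNotDvd K m) :=
  Nat.Coprime.prod_right fun _ hp =>
    (((Finset.mem_filter.1 hp).2.1.coprime_iff_not_dvd).2 (Finset.mem_filter.1 hp).2.2).symm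

theorem dvd_primesProdNotDvd {K m p : ℕ} (hp : p.Prime) (hpK : p ≤ K) (hpm : ¬ p ∣ m) :
    p ∣ primesProdNotDvd K m :=
  Finset.dvd_prod_of_mem (fun p => p)
    (Finset.mem_filter.2 ⟨Finset.mem_range.2 (Nat.lt_succ_of_le hpK), hp, hpm⟩)

/-- The residues of `n` at the primes up to `K`: exact `2`-adic and `5`-adic data, divisibility
by `q` with cofactor `1` modulo `q`, and residue `3` at all other primes. -/
theorem exists_prescribed_residues (K : ℕ) {q : ℕ} (hq0 : 0 < q) (hq2 : ¬ 2 ∣ q) :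
    ∃ n k : ℕ, 3 ≤ n ∧ n % 8 = 5 ∧ (¬ 5 ∣ q → n % 25 = 4) ∧ n = q * (1 + q * k) ∧
      ∀ p : ℕ, p.Prime → p ≤ K → p ≠ 2 → p ≠ 5 → ¬ p ∣ q → n ≡ 3 [MOD p] := by
  have h2 : Nat.Coprime 2 q := (Nat.prime_two.coprime_iff_not_dvd).2 hq2
  have hM := coprime_primesProdNotDvd K (10 * q)
  have h10M : Nat.Coprime 10 (primesProdNotDvd K (10 * q)) := hM.coprime_mul_right
  have hqM : Nat.Coprime q (primesProdNotDvd K (10 * q)) := hM.coprime_mul_left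
  obtain ⟨c, hc0, hcq, hcM, hc8, hc25⟩ : ∃ c : ℕ, 0 < c ∧ c.Coprime q ∧
      c.Coprime (primesProdNotDvd K (10 * q)) ∧ 8 ∣ c ∧ (¬ 5 ∣ q → 25 ∣ c) := by
    by_cases h5 : 5 ∣ q
    · refine ⟨8, by norm_num, Nat.Coprime.pow_left 3 h2, ?_, dvd_rfl, fun h => absurd h5 h⟩
      exact (h10M.pow_left 3).coprime_dvd_left (by norm_num)
    · have h5q : Nat.Coprime 5 q := (Nat.prime_five.coprime_iff_not_dvd).2 h5
      refine ⟨200, by norm_num, ?_, ?_, by norm_num, fun _ => by norm_num⟩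
      · exact ((h2.mul_left h5q).pow_left 3).coprime_dvd_left (by norm_num)
      · exact (h10M.pow_left 3).coprime_dvd_left (by norm_num)
  obtain ⟨n, hn, hnc, hnq, hnM⟩ := Nat.exists_modEq_three hc0 (pow_pos hq0 2)
    (primesProdNotDvd_pos K (10 * q)) (hcq.pow_right 2) hcM (hqM.pow_left 2) 29 q 3 (q + 3)
  obtain ⟨k, hk⟩ := (Nat.modEq_iff_dvd' (by omega : q ≤ n)).1 hnq.symm
  refine ⟨n, k, by omega, hnc.of_dvd hc8, fun h5 => hnc.of_dvd (hc25 h5), ?_, ?_⟩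
  · have : n = q + q ^ 2 * k := by omega
    rw [this]; ring
  · intro p hp hpK hp2 hp5 hpq
    refine hnM.of_dvd (dvd_primesProdNotDvd hp hpK fun h => ?_)
    rcases hp.dvd_mul.1 h with h | h
    · rcases hp.dvd_mul.1 (show p ∣ 2 * 5 from h) with h | h
      · exact hp2 ((Nat.prime_dvd_prime_iff_eq hp Nat.prime_two).1 h)
      · exact hp5 ((Nat.prime_dvd_prime_iff_eq hp Nat.prime_five).1 h)
    · exact hpq h

theorem Nat.Prime.seven_le {p : ℕ} (hp : p.Prime) (h2 : p ≠ 2) (h3 : p ≠ 3) (h5 : p ≠ 5) :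
    7 ≤ p := by
  by_contra! h
  have := hp.two_le
  interval_cases p <;> first | omega | (revert hp; norm_num)

theorem not_dvd_add_of_modEq_three {n p : ℕ} (hn : 3 ≤ n) (hp : 7 ≤ p) (h : n ≡ 3 [MOD p]) :
    ¬ p ∣ n - 2 ∧ ¬ p ∣ n - 1 ∧ ¬ p ∣ n ∧ ¬ p ∣ n + 1 ∧ ¬ p ∣ n + 2 := by
  obtain ⟨k, hk⟩ := (Nat.modEq_iff_dvd' hn).1 h.symm
  have key : ∀ m j : ℕ, m = j + p * k → 0 < j → j < p → ¬ p ∣ m := by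
    rintro m j rfl hj hjp hd
    exact absurd (Nat.le_of_dvd hj ((Nat.dvd_add_left (dvd_mul_right p k)).1 hd)) (by omega)
  exact ⟨key _ 1 (by omega) (by omega) (by omega), key _ 2 (by omega) (by omega) (by omega),
    key _ 3 (by omega) (by omega) (by omega), key _ 4 (by omega) (by omega) (by omega),
    key _ 5 (by omega) (by omega) (by omega)⟩

theorem not_dvd_add_of_dvd {n p : ℕ} (hn : 3 ≤ n) (hp : 3 ≤ p) (h : p ∣ n) :
    ¬ p ∣ n - 2 ∧ ¬ p ∣ n - 1 ∧ ¬ p ∣ n + 1 ∧ ¬ p ∣ n + 2 := by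
  have key : ∀ j : ℕ, 0 < j → j < 3 → ¬ p ∣ j := fun j hj hj3 hd =>
    absurd (Nat.le_of_dvd hj hd) (by omega)
  refine ⟨fun hd => key 2 (by omega) (by omega) ?_, fun hd => key 1 (by omega) (by omega) ?_,
    fun hd => key 1 (by omega) (by omega) ((Nat.dvd_add_right h).1 hd),
    fun hd => key 2 (by omega) (by omega) ((Nat.dvd_add_right h).1 hd)⟩
  · exact (Nat.dvd_add_right hd).1 (by rwa [Nat.sub_add_cancel (by omega)])
  · exact (Nat.dvd_add_right hd).1 (by rwa [Nat.sub_add_cancel (by omega)])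

theorem stmt_7 (K : ℕ) (hK : 2 ≤ K) (q : ℕ) (hq : q ∈ QSet K)
    (hq3 : 3 ∣ q) (hq2 : ¬ 2 ∣ q) :
    ∃ n : ℕ, 3 ≤ n ∧ ∀ r ∈ QSet K,
      (r ∣ n - 2 ↔ r = 1) ∧ (r ∣ n - 1 ↔ r ∣ 4) ∧ (r ∣ n ↔ r ∣ q) ∧
        (5 ∣ q → (r ∣ n + 1 ↔ r ∣ 2)) ∧ (¬ 5 ∣ q → (r ∣ n + 1 ↔ r ∣ 10)) ∧
        (r ∣ n + 2 ↔ r = 1) := by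
  obtain ⟨n, k, hn, hn8, hn25, hnq, hnp⟩ := exists_prescribed_residues K hq.1 hq2
  have hqn : q ∣ n := ⟨_, hnq⟩
  have hodd : ∀ p : ℕ, p.Prime → p ∣ q → 3 ≤ p := fun p hp hpq => by
    have := hp.two_le
    have : p ≠ 2 := by rintro rfl; exact hq2 hpq
    omega
  have cases_prime : ∀ p : ℕ, p.Prime → p ≤ K → p = 2 ∨ (p = 5 ∧ ¬ 5 ∣ q) ∨
      (¬ p ∣ n - 2 ∧ ¬ p ∣ n - 1 ∧ (¬ p ∣ q → ¬ p ∣ n) ∧ ¬ p ∣ n + 1 ∧ ¬ p ∣ n + 2) := by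
    intro p hp hpK
    by_cases hpq : p ∣ q
    · obtain ⟨h₁, h₂, h₃, h₄⟩ := not_dvd_add_of_dvd hn (hodd p hp hpq) (hpq.trans hqn)
      exact Or.inr (Or.inr ⟨h₁, h₂, fun h => absurd hpq h, h₃, h₄⟩)
    by_cases hp2 : p = 2
    · exact Or.inl hp2
    by_cases hp5 : p = 5
    · subst hp5; exact Or.inr (Or.inl ⟨rfl, hpq⟩)
    have hp3 : p ≠ 3 := by rintro rfl; exact hpq hq3
    obtain ⟨h₁, h₂, h₃, h₄, h₅⟩ := not_dvd_add_of_modEq_three hn (hp.seven_le hp2 hp3 hp5)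
      (hnp p hp hpK hp2 hp5 hpq)
    exact Or.inr (Or.inr ⟨h₁, h₂, fun _ => h₃, h₄, h₅⟩)
  refine ⟨n, hn, fun r hr => ⟨?_, ?_, ?_, fun h5 => ?_, fun h5 => ?_, ?_⟩⟩
  · rw [← Nat.dvd_one, ← one_mul (n - 2)]
    refine QSet.dvd_mul_iff hr fun p hp hpK hd => ?_
    rcases cases_prime p hp hpK with rfl | ⟨rfl, h5⟩ | h
    · omega
    · have := hn25 h5; omega
    · exact h.1 hd
  · obtain ⟨u, hu⟩ : 4 ∣ n - 1 := by omega
    rw [hu]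
    refine QSet.dvd_mul_iff hr fun p hp hpK hd => ?_
    rcases cases_prime p hp hpK with rfl | ⟨rfl, h5⟩ | h
    · omega
    · have := hn25 h5; omega
    · exact h.2.1 (hu ▸ hd.mul_left 4)
  · rw [hnq]
    refine QSet.dvd_mul_iff hr fun p hp hpK hd => ?_
    have hdn : p ∣ n := hnq ▸ hd.mul_left q
    by_cases hpq : p ∣ q
    · exact hp.one_lt.ne' (Nat.dvd_one.1 ((Nat.dvd_add_left (hpq.mul_right k)).1 hd))
    rcases cases_prime p hp hpK with rfl | ⟨rfl, h5⟩ | h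
    · omega
    · have := hn25 h5; omega
    · exact h.2.2.1 hpq hdn
  · obtain ⟨u, hu⟩ : 2 ∣ n + 1 := by omega
    rw [hu]
    refine QSet.dvd_mul_iff hr fun p hp hpK hd => ?_
    rcases cases_prime p hp hpK with rfl | ⟨rfl, h⟩ | h
    · omega
    · exact h h5
    · exact h.2.2.2.1 (hu ▸ hd.mul_left 2)
  · have h25 := hn25 h5
    obtain ⟨u, hu⟩ : 10 ∣ n + 1 := by omega
    rw [hu]
    refine QSet.dvd_mul_iff hr fun p hp hpK hd => ?_
    rcases cases_prime p hp hpK with rfl | ⟨rfl, h⟩ | h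
    · omega
    · omega
    · exact h.2.2.2.1 (hu ▸ hd.mul_left 10)
  · rw [← Nat.dvd_one, ← one_mul (n + 2)]
    refine QSet.dvd_mul_iff hr fun p hp hpK hd => ?_
    rcases cases_prime p hp hpK with rfl | ⟨rfl, h5⟩ | h
    · omega
    · have := hn25 h5; omega
    · exact h.2.2.2.2 hd
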